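/- Under the stated setup, the expected cross-entropy of the random model distribution P against the one-hot empirical distribution P₀ concentrated at y₀ decomposes exactly into a squared-bias term and a variance term: ∫ H(P₀, P_ω) dμ(ω) = D_KL(P₀ ‖ P̄) + ∫ D_KL(P̄ ‖ P_ω) dμ(ω), where P̄ is the normalized geometric mean of the family (P_ω). (This is the token-level bias–variance decomposition of the cross-entropy loss, Eq. (10) of the paper.) -/

import Mathlib

open MeasureTheory

/-- Geometric mean of the model probabilities of `y` over the training
distribution: `exp(∫ log P_ω(y) dμ(ω))`. -/
noncomputable def geomMean {Ω Y : Type*} [MeasurableSpace Ω]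
    (μ : Measure Ω) (P : Ω → Y → ℝ) (y : Y) : ℝ :=
  Real.exp (∫ ω, Real.log (P ω y) ∂μ)

/-- Normalizing constant `Z = Σ_y exp(∫ log P_ω(y) dμ(ω))`. -/
noncomputable def Zconst {Ω Y : Type*} [MeasurableSpace Ω] [Fintype Y]
    (μ : Measure Ω) (P : Ω → Y → ℝ) : ℝ :=
  ∑ y, geomMean μ P y

/-- Normalized geometric mean `P̄(y) = exp(∫ log P_ω(y) dμ(ω)) / Z`. -/
noncomputable def geomMeanBar {Ω Y : Type*} [MeasurableSpace Ω] [Fintype Y]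
    (μ : Measure Ω) (P : Ω → Y → ℝ) (y : Y) : ℝ :=
  geomMean μ P y / Zconst μ P

/-- One-hot (empirical) distribution concentrated at `y₀`. -/
def oneHot {Y : Type*} [DecidableEq Y] (y₀ y : Y) : ℝ :=
  if y = y₀ then 1 else 0

/-- Cross-entropy `H(p, q) = −Σ_y p(y) log q(y)`. -/
noncomputable def crossEntropy {Y : Type*} [Fintype Y] (p q : Y → ℝ) : ℝ :=
  -∑ y, p y * Real.log (q y)

/-- Kullback–Leibler divergence `D_KL(p ‖ q) = Σ_y p(y) log(p(y)/q(y))`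
(with the convention `0 · log 0 = 0`). -/
noncomputable def klDiv' {Y : Type*} [Fintype Y] (p q : Y → ℝ) : ℝ :=
  ∑ y, p y * Real.log (p y / q y)

section

variable {Ω Y : Type*} [MeasurableSpace Ω] (μ : Measure Ω) (P : Ω → Y → ℝ)

theorem geomMean_pos (y : Y) : 0 < geomMean μ P y :=
  Real.exp_pos _

variable [Fintype Y] [Nonempty Y]

theorem Zconst_pos : 0 < Zconst μ P :=
  Finset.sum_pos (fun y _ => geomMean_pos μ P y) Finset.univ_nonempty

theorem geomMeanBar_pos (y : Y) : 0 < geomMeanBar μ P y :=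
  div_pos (geomMean_pos μ P y) (Zconst_pos μ P)

theorem sum_geomMeanBar : ∑ y, geomMeanBar μ P y = 1 := by
  simp only [geomMeanBar, ← Finset.sum_div]
  exact div_self (Zconst_pos μ P).ne'

theorem log_geomMeanBar (y : Y) :
    Real.log (geomMeanBar μ P y) = ∫ ω, Real.log (P ω y) ∂μ - Real.log (Zconst μ P) := by
  rw [geomMeanBar, Real.log_div (geomMean_pos μ P y).ne' (Zconst_pos μ P).ne', geomMean,
    Real.log_exp]

/-- The expected divergence of the family from its normalized geometric mean is `-log Z`. -/
theorem integral_klDiv'_geomMeanBar [IsProbabilityMeasure μ]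
    (hpos : ∀ ω y, 0 < P ω y)
    (hlogint : ∀ y, Integrable (fun ω => Real.log (P ω y)) μ) :
    ∫ ω, klDiv' (geomMeanBar μ P) (P ω) ∂μ = -Real.log (Zconst μ P) := by
  have hlog (ω : Ω) (y : Y) : Real.log (geomMeanBar μ P y / P ω y)
      = Real.log (geomMeanBar μ P y) - Real.log (P ω y) :=
    Real.log_div (geomMeanBar_pos μ P y).ne' (hpos ω y).ne'
  have hterm (y : Y) :
      ∫ ω, geomMeanBar μ P y * (Real.log (geomMeanBar μ P y) - Real.log (P ω y)) ∂μ
        = geomMeanBar μ P y * -Real.log (Zconst μ P) := by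
    rw [integral_const_mul, integral_sub (integrable_const _) (hlogint y), integral_const,
      probReal_univ, one_smul, log_geomMeanBar]
    ring
  simp only [klDiv', hlog]
  rw [integral_finsetSum]
  · simp only [hterm]
    rw [← Finset.sum_mul, sum_geomMeanBar, one_mul]
  · exact fun y _ => ((integrable_const _).sub (hlogint y)).const_mul _

end

theorem crossEntropy_oneHot {Y : Type*} [Fintype Y] [DecidableEq Y] (y₀ : Y) (q : Y → ℝ) :
    crossEntropy (oneHot y₀) q = -Real.log (q y₀) := by
  simp [crossEntropy, oneHot]

theorem klDiv'_oneHot {Y : Type*} [Fintype Y] [DecidableEq Y] (y₀ : Y) (q : Y → ℝ) :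
    klDiv' (oneHot y₀) q = -Real.log (q y₀) := by
  simp [klDiv', oneHot]

/-- **Bias–variance decomposition of the expected cross-entropy (Eq. (10)).**
For a family of strictly positive probability mass functions `P_ω` on a finite
type `Y` and the one-hot empirical distribution `P₀` at `y₀`,
`∫ H(P₀, P_ω) dμ = D_KL(P₀ ‖ P̄) + ∫ D_KL(P̄ ‖ P_ω) dμ`,
where `P̄` is the normalized geometric mean of the family `(P_ω)`. -/
theorem expected_crossEntropy_bias_variance_decomposition
    {Ω Y : Type*} [MeasurableSpace Ω] [Fintype Y] [Nonempty Y] [DecidableEq Y]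
    (μ : Measure Ω) [IsProbabilityMeasure μ]
    (P : Ω → Y → ℝ) (y₀ : Y)
    (hpos : ∀ ω y, 0 < P ω y)
    (hsum : ∀ ω, ∑ y, P ω y = 1)
    (hmeas : ∀ y, Measurable fun ω => P ω y)
    (hlogint : ∀ y, Integrable (fun ω => Real.log (P ω y)) μ) :
    ∫ ω, crossEntropy (oneHot y₀) (P ω) ∂μ
      = klDiv' (oneHot y₀) (geomMeanBar μ P)
        + ∫ ω, klDiv' (geomMeanBar μ P) (P ω) ∂μ := by
  rw [integral_klDiv'_geomMeanBar μ P hpos hlogint, klDiv'_oneHot, log_geomMeanBar]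
  simp only [crossEntropy_oneHot]
  rw [integral_neg]
  ring
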